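/- Integrality property of the intersection number: for any two continuous paths of Lagrangian subspaces L1, L2 of a real symplectic vector space (E, ω) on [a,b], the number [L1 : L2] + (1/2)dim(L1(a) ∩ L2(a)) + (1/2)dim(L1(b) ∩ L2(b)) is an integer. In particular, [L1 : L2] is an integer if L1(a) ∩ L2(a) = {0} and L1(b) ∩ L2(b) = {0}. -/

import Mathlib

open LinearMap (BilinForm)

variable {E : Type*} [NormedAddCommGroup E] [NormedSpace ℝ E]

/-- A subspace is Lagrangian iff it equals its symplectic orthogonal. -/
def IsLagrangian (ω : BilinForm ℝ E) (L : Submodule ℝ E) : Prop :=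
  LinearMap.BilinForm.orthogonal ω L = L

/-- Maximal dimension of a subspace on which the function `Q` is positive away from `0`. -/
noncomputable def posIndex {V : Type*} [AddCommGroup V] [Module ℝ V] (Q : V → ℝ) : ℕ :=
  sSup {d : ℕ | ∃ W : Submodule ℝ V, Module.finrank ℝ W = d ∧ ∀ x ∈ W, x ≠ 0 → 0 < Q x}

/-- The quadratic form `Q(L1,L2,L3)` of a triplet of subspaces,
`Q(x1,x2,x3) = ω(x1,x2) + ω(x2,x3) + ω(x3,x1)`. -/
def tripleQ (ω : BilinForm ℝ E) (L1 L2 L3 : Submodule ℝ E) (v : L1 × L2 × L3) : ℝ :=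
  ω v.1 v.2.1 + ω v.2.1 v.2.2 + ω v.2.2 v.1

/-- The signature `s(L1,L2,L3)` of a triplet of subspaces: the signature (number of positive
squares minus number of negative squares in a diagonalization) of `Q(L1,L2,L3)`. -/
noncomputable def tripleSig (ω : BilinForm ℝ E) (L1 L2 L3 : Submodule ℝ E) : ℤ :=
  (posIndex (tripleQ ω L1 L2 L3) : ℤ) - (posIndex (fun v => - tripleQ ω L1 L2 L3 v) : ℤ)

/-- A continuous path of Lagrangian subspaces of `(E, ω)` on the interval `[a,b]`:  a family
`(L t)` of Lagrangian subspaces such that every `t0 ∈ [a,b]` has a neighbourhood `U` in `[a,b]`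
on which there is a continuous family of idempotent linear maps of `E` with range `L t`. -/
structure IsLagrangianPath (ω : BilinForm ℝ E) (a b : ℝ) (L : ℝ → Submodule ℝ E) : Prop where
  lag : ∀ t ∈ Set.Icc a b, IsLagrangian ω (L t)
  locTriv : ∀ t0 ∈ Set.Icc a b, ∃ U ∈ nhdsWithin t0 (Set.Icc a b), U ⊆ Set.Icc a b ∧
    ∃ P : ℝ → E →L[ℝ] E, ContinuousOn P U ∧
      ∀ t ∈ U, (P t).comp (P t) = P t ∧ LinearMap.range (P t : E →ₗ[ℝ] E) = L t

/-- A jointly continuous two-parameter family `(L s t)`, `s ∈ [0,1]`, `t ∈ [a,b]`, of Lagrangian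
subspaces (a homotopy of paths of Lagrangian subspaces). -/
structure IsLagrangianHomotopy (ω : BilinForm ℝ E) (a b : ℝ)
    (L : ℝ → ℝ → Submodule ℝ E) : Prop where
  lag : ∀ s ∈ Set.Icc (0:ℝ) 1, ∀ t ∈ Set.Icc a b, IsLagrangian ω (L s t)
  locTriv : ∀ p ∈ Set.Icc (0:ℝ) 1 ×ˢ Set.Icc a b,
    ∃ U ∈ nhdsWithin p (Set.Icc (0:ℝ) 1 ×ˢ Set.Icc a b),
      U ⊆ Set.Icc (0:ℝ) 1 ×ˢ Set.Icc a b ∧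
      ∃ P : ℝ × ℝ → E →L[ℝ] E, ContinuousOn P U ∧
        ∀ q ∈ U, (P q).comp (P q) = P q ∧ LinearMap.range (P q : E →ₗ[ℝ] E) = L q.1 q.2

/-- Admissible data for a pair of paths of Lagrangian subspaces on `[a,b]`:  a partition
`a = t_0 ≤ t_1 ≤ … ≤ t_k = b` together with Lagrangian subspaces `M_1, …, M_k` such that
`M_ν ∩ L_i(t) = 0` for all `t ∈ [t_{ν-1}, t_ν]`, `i = 1,2`.  (Here `M (ν+1)` plays the role
of `M_{ν+1}` for `0 ≤ ν < k`.) -/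
structure AdmissibleData (ω : BilinForm ℝ E) (a b : ℝ) (L1 L2 : ℝ → Submodule ℝ E) where
  k : ℕ
  kpos : 0 < k
  t : ℕ → ℝ
  M : ℕ → Submodule ℝ E
  ht0 : t 0 = a
  htk : t k = b
  hmono : ∀ ν < k, t ν ≤ t (ν + 1)
  hlag : ∀ ν < k, IsLagrangian ω (M (ν + 1))
  htrans1 : ∀ ν < k, ∀ s ∈ Set.Icc (t ν) (t (ν + 1)), M (ν + 1) ⊓ L1 s = ⊥
  htrans2 : ∀ ν < k, ∀ s ∈ Set.Icc (t ν) (t (ν + 1)), M (ν + 1) ⊓ L2 s = ⊥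

/-- The expression `(1/2) Σ_ν ( s(L1(t_{ν-1}), L2(t_{ν-1}), M_ν) − s(L1(t_ν), L2(t_ν), M_ν) )`
computed from admissible data; by well-definedness this is the intersection number `[L1 : L2]`. -/
noncomputable def dataSum {ω : BilinForm ℝ E} {a b : ℝ} {L1 L2 : ℝ → Submodule ℝ E}
    (D : AdmissibleData ω a b L1 L2) : ℝ :=
  (1 / 2 : ℝ) * ∑ ν ∈ Finset.range D.k,
    ((tripleSig ω (L1 (D.t ν)) (L2 (D.t ν)) (D.M (ν + 1)) : ℝ)
      - (tripleSig ω (L1 (D.t (ν + 1))) (L2 (D.t (ν + 1))) (D.M (ν + 1)) : ℝ))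

/-- A continuous path of symplectic automorphisms of `(E, ω)` on `[a,b]`. -/
structure IsSymplecticPath (ω : BilinForm ℝ E) (a b : ℝ) (A : ℝ → E →L[ℝ] E) : Prop where
  bij : ∀ t ∈ Set.Icc a b, Function.Bijective (A t)
  symp : ∀ t ∈ Set.Icc a b, ∀ x y, ω (A t x) (A t y) = ω x y
  cont : ContinuousOn A (Set.Icc a b)

/-- The symplectic form of `E × E⁻`: `((x1,x2),(y1,y2)) ↦ ω(x1,y1) − ω(x2,y2)`. -/
noncomputable def prodNegForm (ω : BilinForm ℝ E) : BilinForm ℝ (E × E) :=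
  LinearMap.mk₂ ℝ (fun x y => ω x.1 y.1 - ω x.2 y.2)
    (fun x x' y => by simp only [Prod.fst_add, Prod.snd_add, map_add, LinearMap.add_apply]; ring)
    (fun c x y => by
      simp only [Prod.smul_fst, Prod.smul_snd, map_smul, LinearMap.smul_apply, smul_eq_mul]; ring)
    (fun x y y' => by simp only [Prod.fst_add, Prod.snd_add, map_add]; ring)
    (fun c x y => by simp only [Prod.smul_fst, Prod.smul_snd, map_smul, smul_eq_mul]; ring)

/-- The graph `Γ_A = {(A x, x)}` of an endomorphism, as a subspace of `E × E`. -/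
def graphSub (A : E →L[ℝ] E) : Submodule ℝ (E × E) :=
  LinearMap.range ((A : E →ₗ[ℝ] E).prod LinearMap.id)

/-- The diagonal `Δ = {(x, x)}` in `E × E`. -/
def diagSub : Submodule ℝ (E × E) :=
  LinearMap.range ((LinearMap.id : E →ₗ[ℝ] E).prod LinearMap.id)

theorem posIndex_eq_sigPos {V : Type*} [AddCommGroup V] [Module ℝ V] [FiniteDimensional ℝ V]
    (Q : QuadraticForm ℝ V) : posIndex Q = sigPos Q := by
  refine (congrArg sSup ?_).trans (sigPos_isGreatest Q).csSup_eq
  ext d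
  refine exists_congr fun W => and_congr_right fun _ => ⟨fun h x hx => ?_, fun h x hx hx0 => ?_⟩
  · exact h x x.2 (by simpa using hx)
  · exact h ⟨x, hx⟩ (by simpa using hx0)

/-- `tripleQ` as a bundled quadratic form. -/
noncomputable def tripleForm (ω : BilinForm ℝ E) (L1 L2 L3 : Submodule ℝ E) :
    QuadraticForm ℝ (L1 × L2 × L3) :=
  let p1 : L1 × L2 × L3 →ₗ[ℝ] E := L1.subtype ∘ₗ LinearMap.fst ℝ _ _
  let p2 : L1 × L2 × L3 →ₗ[ℝ] E := L2.subtype ∘ₗ LinearMap.fst ℝ _ _ ∘ₗ LinearMap.snd ℝ _ _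
  let p3 : L1 × L2 × L3 →ₗ[ℝ] E := L3.subtype ∘ₗ LinearMap.snd ℝ _ _ ∘ₗ LinearMap.snd ℝ _ _
  LinearMap.BilinMap.toQuadraticMap
    (ω.compl₁₂ p1 p2 + ω.compl₁₂ p2 p3 + ω.compl₁₂ p3 p1)

theorem tripleForm_apply (ω : BilinForm ℝ E) (L1 L2 L3 : Submodule ℝ E) (v : L1 × L2 × L3) :
    tripleForm ω L1 L2 L3 v = ω v.1 v.2.1 + ω v.2.1 v.2.2 + ω v.2.2 v.1 :=
  rfl

theorem tripleSig_eq [FiniteDimensional ℝ E] (ω : BilinForm ℝ E) (L1 L2 L3 : Submodule ℝ E) :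
    tripleSig ω L1 L2 L3 =
      (sigPos (tripleForm ω L1 L2 L3) : ℤ) - (sigNeg (tripleForm ω L1 L2 L3) : ℤ) := by
  rw [← sigPos_neg, ← posIndex_eq_sigPos, ← posIndex_eq_sigPos]
  rfl

theorem IsLagrangian.mem_of_forall {ω : BilinForm ℝ E} {L : Submodule ℝ E}
    (hL : IsLagrangian ω L) {x : E} (hx : ∀ y ∈ L, ω y x = 0) : x ∈ L := by
  rw [← hL]
  exact hx

theorem IsLagrangian.apply_eq_zero {ω : BilinForm ℝ E} {L : Submodule ℝ E}
    (hL : IsLagrangian ω L) {x y : E} (hx : x ∈ L) (hy : y ∈ L) : ω x y = 0 := by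
  rw [← hL] at hy
  exact hy x hx

theorem IsLagrangian.two_mul_finrank [FiniteDimensional ℝ E] {ω : BilinForm ℝ E}
    (hnd : LinearMap.BilinForm.Nondegenerate ω) {L : Submodule ℝ E} (hL : IsLagrangian ω L) :
    2 * Module.finrank ℝ L = Module.finrank ℝ E := by
  have h := LinearMap.BilinForm.finrank_orthogonal hnd L
  rw [show LinearMap.BilinForm.orthogonal ω L = L from hL] at h
  have := L.finrank_le
  lia

/-- If `L3` is transverse to `L1` and `L2`, the radical of the triple form is
`{(x, x, 0) : x ∈ L1 ∩ L2}`. -/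
theorem finrank_radical_tripleForm {ω : BilinForm ℝ E} (halt : LinearMap.IsAlt ω)
    {L1 L2 L3 : Submodule ℝ E} (h1 : IsLagrangian ω L1) (h2 : IsLagrangian ω L2)
    (h3 : IsLagrangian ω L3) (h31 : L3 ⊓ L1 = ⊥) (h32 : L3 ⊓ L2 = ⊥) :
    Module.finrank ℝ (tripleForm ω L1 L2 L3).radical = Module.finrank ℝ ↥(L1 ⊓ L2) := by
  have skew (x y : E) : ω x y = -ω y x := (halt.neg y x).symm
  let f : ↥(L1 ⊓ L2) →ₗ[ℝ] L1 × L2 × L3 :=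
    (Submodule.inclusion inf_le_left).prod ((Submodule.inclusion inf_le_right).prod 0)
  have hf : Function.Injective f := fun x y h =>
    Subtype.ext (congrArg (fun v : L1 × L2 × L3 => (v.1 : E)) h)
  rw [← LinearMap.finrank_range_of_inj hf]
  suffices h : (tripleForm ω L1 L2 L3).radical = LinearMap.range f by rw [h]
  ext ⟨x1, x2, x3⟩
  rw [QuadraticMap.mem_radical_iff', LinearMap.mem_range]
  constructor
  · rintro ⟨hQ, hpol⟩
    simp only [tripleForm_apply] at hQ hpol
    have e1 : (x2 - x3 : E) ∈ L1 := h1.mem_of_forall fun y hy => by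
      have := hpol (⟨y, hy⟩, 0, 0)
      have := skew x3 y
      simp at *
      linarith
    have e2 : (x3 - x1 : E) ∈ L2 := h2.mem_of_forall fun y hy => by
      have := hpol (0, ⟨y, hy⟩, 0)
      have := skew x1 y
      simp at *
      linarith
    have e3 : (x1 - x2 : E) ∈ L3 := h3.mem_of_forall fun y hy => by
      have := hpol (0, 0, ⟨y, hy⟩)
      have := skew x2 y
      simp at *
      linarith
    have z1 : (x1 - x2 + x3 : E) = 0 := by
      rw [← Submodule.mem_bot ℝ, ← h31]
      refine Submodule.mem_inf.mpr ⟨L3.add_mem e3 x3.2, ?_⟩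
      convert L1.sub_mem x1.2 e1 using 1
      abel
    have z2 : (x1 - x2 - x3 : E) = 0 := by
      rw [← Submodule.mem_bot ℝ, ← h32]
      refine Submodule.mem_inf.mpr ⟨L3.sub_mem e3 x3.2, ?_⟩
      convert L2.neg_mem (L2.add_mem x2.2 e2) using 1
      abel
    have hx3 : (x3 : E) = 0 := by
      have : (2 : ℝ) • (x3 : E) = 0 := by
        rw [two_smul, ← sub_eq_zero.mpr (z1.trans z2.symm)]
        abel
      simpa using this
    have hx12 : (x1 : E) = x2 := by
      rwa [hx3, add_zero, sub_eq_zero] at z1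
    exact ⟨⟨x1, x1.2, hx12 ▸ x2.2⟩, Prod.ext rfl (Prod.ext (Subtype.ext hx12)
      (Subtype.ext hx3.symm))⟩
  · rintro ⟨⟨x, hx1, hx2⟩, hx⟩
    obtain ⟨rfl, rfl, rfl⟩ : (⟨x, hx1⟩ : L1) = x1 ∧ (⟨x, hx2⟩ : L2) = x2 ∧ (0 : L3) = x3 :=
      ⟨congrArg (fun v => v.1) hx, congrArg (fun v => v.2.1) hx, congrArg (fun v => v.2.2) hx⟩
    refine ⟨?_, fun ⟨y1, y2, y3⟩ => ?_⟩
    · simp [tripleForm_apply, halt.self_eq_zero]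
    · have a1 := h1.apply_eq_zero y1.2 hx1
      have a2 := h2.apply_eq_zero hx2 y2.2
      have := skew y3 x
      simp only [tripleForm_apply, Prod.fst_add, Prod.snd_add, Submodule.coe_add, map_add,
        LinearMap.add_apply, halt.self_eq_zero, a1, a2, ZeroMemClass.coe_zero, map_zero,
        LinearMap.zero_apply]
      linarith

theorem even_tripleSig_sub {ω : BilinForm ℝ E} [FiniteDimensional ℝ E]
    (halt : LinearMap.IsAlt ω) (hnd : LinearMap.BilinForm.Nondegenerate ω)
    {L1 L2 L3 : Submodule ℝ E} (h1 : IsLagrangian ω L1) (h2 : IsLagrangian ω L2)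
    (h3 : IsLagrangian ω L3) (h31 : L3 ⊓ L1 = ⊥) (h32 : L3 ⊓ L2 = ⊥) :
    Even (tripleSig ω L1 L2 L3 - (Module.finrank ℝ L3 + Module.finrank ℝ ↥(L1 ⊓ L2) : ℤ)) := by
  have hs := QuadraticForm.sigPos_add_sigNeg_add_radical (Q := tripleForm ω L1 L2 L3)
  rw [finrank_radical_tripleForm halt h1 h2 h3 h31 h32, Module.finrank_prod,
    Module.finrank_prod] at hs
  have d1 := h1.two_mul_finrank hnd
  have d2 := h2.two_mul_finrank hnd
  have d3 := h3.two_mul_finrank hnd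
  rw [tripleSig_eq, Int.even_iff]
  lia

theorem AdmissibleData.t_mem_Icc {ω : BilinForm ℝ E} {a b : ℝ} {L1 L2 : ℝ → Submodule ℝ E}
    (D : AdmissibleData ω a b L1 L2) {ν : ℕ} (hν : ν ≤ D.k) : D.t ν ∈ Set.Icc a b := by
  have hmono : MonotoneOn D.t (Set.Icc 0 D.k) :=
    monotoneOn_of_le_succ Set.ordConnected_Icc fun i _ _ hi => D.hmono i hi.2
  exact ⟨D.ht0.symm.trans_le (hmono ⟨le_rfl, zero_le⟩ ⟨zero_le, hν⟩ zero_le),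
    (hmono ⟨zero_le, hν⟩ ⟨zero_le, le_rfl⟩ hν).trans_eq D.htk⟩

/-- integrality of the intersection number:
`[L1 : L2] + (1/2)dim(L1(a)∩L2(a)) + (1/2)dim(L1(b)∩L2(b))` is an integer; in particular
`[L1 : L2]` is an integer when the intersections at the endpoints are trivial. -/
theorem intersection_number_integrality [FiniteDimensional ℝ E]
    (ω : BilinForm ℝ E) (halt : LinearMap.IsAlt ω)
    (hnd : LinearMap.BilinForm.Nondegenerate ω)
    (a b : ℝ) (hab : a ≤ b)
    (L1 L2 : ℝ → Submodule ℝ E)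
    (h1 : IsLagrangianPath ω a b L1) (h2 : IsLagrangianPath ω a b L2)
    (D : AdmissibleData ω a b L1 L2) :
    (∃ m : ℤ, dataSum D + (Module.finrank ℝ ↥(L1 a ⊓ L2 a) : ℝ) / 2
        + (Module.finrank ℝ ↥(L1 b ⊓ L2 b) : ℝ) / 2 = (m : ℝ)) ∧
    (L1 a ⊓ L2 a = ⊥ → L1 b ⊓ L2 b = ⊥ → ∃ m : ℤ, dataSum D = (m : ℝ)) := by
  have hint : ∃ m : ℤ, dataSum D + (Module.finrank ℝ ↥(L1 a ⊓ L2 a) : ℝ) / 2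
      + (Module.finrank ℝ ↥(L1 b ⊓ L2 b) : ℝ) / 2 = (m : ℝ) := by
    let d : ℕ → ℤ := fun ν => Module.finrank ℝ ↥(L1 (D.t ν) ⊓ L2 (D.t ν))
    let S : ℤ := ∑ ν ∈ Finset.range D.k,
      (tripleSig ω (L1 (D.t ν)) (L2 (D.t ν)) (D.M (ν + 1))
        - tripleSig ω (L1 (D.t (ν + 1))) (L2 (D.t (ν + 1))) (D.M (ν + 1)))
    have hS : Even (S + (d D.k - d 0)) := by
      rw [← Finset.sum_range_sub, ← Finset.sum_add_distrib]
      refine Finset.even_sum _ fun ν hν => ?_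
      have hν : ν < D.k := Finset.mem_range.mp hν
      have key {i : ℕ} (hi : i ≤ D.k) (hs : D.t i ∈ Set.Icc (D.t ν) (D.t (ν + 1))) :=
        even_tripleSig_sub halt hnd (h1.lag _ (D.t_mem_Icc hi)) (h2.lag _ (D.t_mem_Icc hi))
          (D.hlag ν hν) (D.htrans1 ν hν _ hs) (D.htrans2 ν hν _ hs)
      have k0 := key hν.le ⟨le_rfl, D.hmono ν hν⟩
      have k1 := key hν ⟨D.hmono ν hν, le_rfl⟩
      convert k0.sub k1 using 1
      simp only [d]
      ring
    have hda : d 0 = Module.finrank ℝ ↥(L1 a ⊓ L2 a) := congrArg (fun s => (Module.finrank ℝ ↥(L1 s ⊓ L2 s) : ℤ)) D.ht0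
    have hdb : d D.k = Module.finrank ℝ ↥(L1 b ⊓ L2 b) := congrArg (fun s => (Module.finrank ℝ ↥(L1 s ⊓ L2 s) : ℤ)) D.htk
    obtain ⟨r, hr⟩ := hS
    refine ⟨r + Module.finrank ℝ ↥(L1 a ⊓ L2 a), ?_⟩
    rw [hda, hdb] at hr
    have hD : dataSum D = (1 / 2 : ℝ) * S := by simp [dataSum, S]
    have hr' := congrArg (Int.cast : ℤ → ℝ) hr
    push_cast at hr' ⊢
    rw [hD]
    linarith
  refine ⟨hint, fun ha hb => ?_⟩
  rw [ha, hb] at hint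
  simpa using hint
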